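/- Let R and S be rings. The categories Mod_R and Mod_S of right modules are equivalent if and only if there is an object P of Mod_S such that: (i) P is a finitely generated projective S-module; (ii) P is a generator of the abelian category Mod_S (i.e., the functor Hom_S(P,−) is faithful); and (iii) the endomorphism ring End_S(P) = Hom_S(P,P) is isomorphic to R as a ring. -/

import Mathlib

open CategoryTheory Limits

universe u

/-- Finite generation is invariant under isomorphism of submodule lattices. -/
theorem finite_of_orderIso {A B : Type u} [Ring A] [Ring B] {M N : Type u} [AddCommGroup M]
    [Module A M] [AddCommGroup N] [Module B N] (e : Submodule A M ≃o Submodule B N)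
    [h : Module.Finite A M] : Module.Finite B N := by
  have h1 := (Submodule.fg_iff_compact _).1 h.fg_top
  refine ⟨(Submodule.fg_iff_compact _).2 ?_⟩
  rw [CompleteLattice.isCompactElement_iff_le_of_directed_sSup_le] at h1 ⊢
  intro s hs hd hle
  have hle' : (⊤ : Submodule A M) ≤ sSup (e.symm '' s) := by
    have := e.symm.monotone hle
    rw [map_top] at this
    rw [sSup_image, ← e.symm.map_sSup]
    exact this
  obtain ⟨x, ⟨y, hy, rfl⟩, hx⟩ := h1 (e.symm '' s) (hs.image _) (by
    rintro _ ⟨a, ha, rfl⟩ _ ⟨b, hb, rfl⟩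
    obtain ⟨c, hc, hac, hbc⟩ := hd a ha b hb
    exact ⟨_, ⟨c, hc, rfl⟩, e.symm.monotone hac, e.symm.monotone hbc⟩) hle'
  refine ⟨y, hy, ?_⟩
  have := e.monotone hx
  rwa [map_top, e.apply_symm_apply] at this

section
variable {S : Type u} [Ring S] (P : ModuleCat.{u} S)

/-- The canonical map from the free module to `Hom (P, ⨁ P)`. -/
noncomputable def freeToHom (I : Type u) :
    (I →₀ (End P)ᵐᵒᵖ) →ₗ[(End P)ᵐᵒᵖ] (P ⟶ ModuleCat.of S (I →₀ P)) :=
  Finsupp.linearCombination (End P)ᵐᵒᵖ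
    (fun i => (ModuleCat.ofHom (Finsupp.lsingle i) : P ⟶ ModuleCat.of S (I →₀ P)))

/-- Evaluation of homs at a point, as additive map. -/
def homEval {M : ModuleCat.{u} S} (p : P) : (P ⟶ M) →+ M where
  toFun f := f.hom p
  map_zero' := rfl
  map_add' _ _ := rfl

theorem freeToHom_apply (I : Type u) (x : I →₀ (End P)ᵐᵒᵖ) (p : P) (i : I) :
    ((freeToHom P I x).hom p : I →₀ P) i = (x i).unop.hom p := by
  classical
  change (homEval P p (freeToHom P I x) : I →₀ P) i = _
  rw [freeToHom, Finsupp.linearCombination_apply, Finsupp.sum, map_sum, Finsupp.finsetSum_apply]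
  have : ∀ j ∈ x.support, (homEval P p (x j • (ModuleCat.ofHom (Finsupp.lsingle j) :
      P ⟶ ModuleCat.of S (I →₀ P))) : I →₀ P) i = if j = i then (x i).unop.hom p else 0 := by
    intro j _
    change (Finsupp.single j ((x j).unop.hom p)) i = _
    rw [Finsupp.single_apply]
    split_ifs with h
    · rw [h]
    · rfl
  rw [Finset.sum_congr rfl this]
  simp only [Finset.sum_ite_eq', Finsupp.mem_support_iff]
  split_ifs with h
  · rfl
  · rw [not_not] at h
    rw [h]; rfl

theorem freeToHom_bijective [Module.Finite S P] (I : Type u) :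
    Function.Bijective (freeToHom P I) := by
  constructor
  · intro x y hxy
    ext i
    apply MulOpposite.unop_injective
    apply ModuleCat.hom_ext
    ext p
    rw [← freeToHom_apply, ← freeToHom_apply, hxy]
  · intro h
    classical
    obtain ⟨s, hs⟩ := (Module.Finite.fg_top : (⊤ : Submodule S P).FG)
    let t : Finset I := s.biUnion fun p => (h.hom p : I →₀ P).support
    have ht : ∀ i, i ∉ t → ∀ p : P, (h.hom p : I →₀ P) i = 0 := by
      intro i hi p
      have : (Finsupp.lapply i ∘ₗ h.hom : P →ₗ[S] P) = 0 := by
        apply LinearMap.ext_on_range (v := ((↑) : s → P))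
        · simpa using hs
        · rintro ⟨p, hp⟩
          by_contra hne
          exact hi (Finset.mem_biUnion.2 ⟨p, hp, Finsupp.mem_support_iff.2 hne⟩)
      exact LinearMap.congr_fun this p
    let x : I →₀ (End P)ᵐᵒᵖ := Finsupp.onFinset t
      (fun i => MulOpposite.op (ModuleCat.ofHom (Finsupp.lapply i ∘ₗ h.hom : P →ₗ[S] P)))
      (by
        intro i hne
        by_contra hi
        apply hne
        apply MulOpposite.unop_injective
        apply ModuleCat.hom_ext
        ext p
        exact ht i hi p)
    refine ⟨x, ?_⟩
    apply ModuleCat.hom_ext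
    refine LinearMap.ext fun p => Finsupp.ext fun i => ?_
    rw [freeToHom_apply]
    rfl

theorem exists_epi [Module.Finite S P] (M : ModuleCat.{u} (End P)ᵐᵒᵖ) :
    ∃ (A : ModuleCat.{u} S) (q : (preadditiveCoyonedaObj P).obj A ⟶ M), Epi q := by
  let e := LinearEquiv.ofBijective _ (freeToHom_bijective P M)
  refine ⟨ModuleCat.of S (M →₀ P), ModuleCat.ofHom
    (Finsupp.linearCombination (End P)ᵐᵒᵖ (id : M → M) ∘ₗ e.symm.toLinearMap), ?_⟩
  refine (ModuleCat.epi_iff_surjective _).2 ?_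
  exact (Finsupp.linearCombination_id_surjective _ _).comp e.symm.surjective

theorem isEquivalence_coyoneda [Module.Finite S P] [Module.Projective S P]
    (hP : IsSeparator P) : (preadditiveCoyonedaObj P).IsEquivalence := by
  have hfull := IsGrothendieckAbelian.GabrielPopescu.full P hP
  have hfaith := (isSeparator_iff_faithful_preadditiveCoyonedaObj P).1 hP
  have : PreservesFiniteColimits (preadditiveCoyonedaObj P) :=
    preservesFiniteColimits_preadditiveCoyonedaObj_of_projective P
  have : (preadditiveCoyonedaObj P).EssSurj := by
    refine ⟨fun M => ?_⟩
    obtain ⟨A, q, hq⟩ := exists_epi P M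
    obtain ⟨B, r, hr⟩ := exists_epi P (kernel q)
    obtain ⟨f, hf⟩ := (preadditiveCoyonedaObj P).map_surjective (r ≫ kernel.ι q)
    refine ⟨cokernel f, ⟨PreservesCokernel.iso (preadditiveCoyonedaObj P) f ≪≫ ?_⟩⟩
    have h1 := Abelian.epiIsCokernelOfKernel _ (kernelIsKernel q)
    have h2 := isCokernelEpiComp h1 r hf
    exact (cokernelIsCokernel _).coconePointUniqueUpToIso h2
  exact { }
end

theorem morita_forward (R S : Type u) [Ring R] [Ring S]
    (e : ModuleCat.{u} Rᵐᵒᵖ ≌ ModuleCat.{u} Sᵐᵒᵖ) :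
      ∃ P : ModuleCat.{u} Sᵐᵒᵖ,
        Module.Finite Sᵐᵒᵖ P ∧
        Module.Projective Sᵐᵒᵖ P ∧
        (∀ (M N : ModuleCat.{u} Sᵐᵒᵖ) (f g : M ⟶ N),
          (∀ h : P ⟶ M, h ≫ f = h ≫ g) → f = g) ∧
        Nonempty (Module.End Sᵐᵒᵖ P ≃+* R) := by
  let G : ModuleCat.{u} Rᵐᵒᵖ := ModuleCat.of Rᵐᵒᵖ Rᵐᵒᵖ
  have hbi : PreservesBinaryBiproducts e.functor :=
    preservesBinaryBiproducts_of_preservesBinaryCoproducts _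
  have hadd : e.functor.Additive := Functor.additive_of_preservesBinaryBiproducts _
  refine ⟨e.functor.obj G, ?_, ?_, ?_, ?_⟩
  · have : Module.Finite Rᵐᵒᵖ G := inferInstanceAs (Module.Finite Rᵐᵒᵖ Rᵐᵒᵖ)
    let o : Subobject G ≃o Subobject (e.functor.obj G) :=
      (Subobject.lowerEquivalence (MonoOver.congr G e)).toOrderIso
    exact finite_of_orderIso (((ModuleCat.subobjectModule G).symm.trans o).trans
      (ModuleCat.subobjectModule (e.functor.obj G)))
  · have : Module.Projective Rᵐᵒᵖ G := inferInstanceAs (Module.Projective Rᵐᵒᵖ Rᵐᵒᵖ)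
    have : Projective (e.functor.obj G) := (e.map_projective_iff G).2 inferInstance
    infer_instance
  · intro M N f g h
    apply e.inverse.map_injective
    apply ModuleCat.hom_ext
    refine LinearMap.ext fun m => ?_
    let k : G ⟶ e.inverse.obj M := ModuleCat.ofHom (LinearMap.toSpanSingleton Rᵐᵒᵖ _ m)
    have h1 : k ≫ e.inverse.map f = k ≫ e.inverse.map g := by
      have h2 := h ((e.toAdjunction.homEquiv _ _).symm k)
      rw [← Adjunction.homEquiv_naturality_right_symm,
        ← Adjunction.homEquiv_naturality_right_symm] at h2
      exact (e.toAdjunction.homEquiv _ _).symm.injective h2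
    have h3 := congrArg (fun z => z.hom (1 : Rᵐᵒᵖ)) h1
    have hk : k.hom (1 : Rᵐᵒᵖ) = m := LinearMap.toSpanSingleton_apply_one _ _ m
    change (e.inverse.map f).hom (k.hom (1 : Rᵐᵒᵖ)) =
      (e.inverse.map g).hom (k.hom (1 : Rᵐᵒᵖ)) at h3
    rwa [hk] at h3
  · let a : End G ≃+* End (e.functor.obj G) :=
      { (Functor.FullyFaithful.ofFullyFaithful e.functor).mulEquivEnd G with
        map_add' := fun x y => e.functor.map_add }
    exact ⟨(ModuleCat.endRingEquiv _).symm.trans (a.symm.trans ((ModuleCat.endRingEquiv G).trans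
      ((RingEquiv.moduleEndSelf Rᵐᵒᵖ).symm.trans (RingEquiv.opOp R).symm)))⟩

theorem morita_classical (R S : Type u) [Ring R] [Ring S] :
    Nonempty (ModuleCat.{u} Rᵐᵒᵖ ≌ ModuleCat.{u} Sᵐᵒᵖ) ↔
      ∃ P : ModuleCat.{u} Sᵐᵒᵖ,
        Module.Finite Sᵐᵒᵖ P ∧
        Module.Projective Sᵐᵒᵖ P ∧
        (∀ (M N : ModuleCat.{u} Sᵐᵒᵖ) (f g : M ⟶ N),
          (∀ h : P ⟶ M, h ≫ f = h ≫ g) → f = g) ∧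
        Nonempty (Module.End Sᵐᵒᵖ P ≃+* R) := by
  constructor
  · rintro ⟨e⟩
    exact morita_forward R S e
  · rintro ⟨P, _, _, hsep, ⟨e⟩⟩
    have hP : IsSeparator P := (isSeparator_def P).2 fun M N f g h => hsep M N f g h
    have := isEquivalence_coyoneda P hP
    let e' : (End P)ᵐᵒᵖ ≃+* Rᵐᵒᵖ := RingEquiv.op ((ModuleCat.endRingEquiv P).trans e)
    exact ⟨(ModuleCat.restrictScalarsEquivalenceOfRingEquiv e').trans
      (preadditiveCoyonedaObj P).asEquivalence.symm⟩
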